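/- Let u, v ∈ ℝ² be linearly independent vectors, let a, b, c, d be positive reals, and set A = v, B = −a·u, C = −b·v, D = u, E = c·u + d·v. Then the quintuple (A, B, C, D, E) is the image, in cyclic order, of the vertices of a regular pentagon under an invertible affine map of ℝ² if and only if a = b = (√5 − 1)/2 and c = d = 1. -/

import Mathlib

open Real

/-- The vertices of the regular pentagon, in cyclic order. -/
noncomputable def regPentagon (k : Fin 5) : ℝ × ℝ :=
  (cos (2 * π * k / 5), sin (2 * π * k / 5))

theorem cos_two_pi_div_five : cos (2 * π / 5) = (√5 - 1) / 4 := by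
  have h : (√5) ^ 2 = 5 := Real.sq_sqrt (by norm_num)
  rw [show 2 * π / 5 = 2 * (π / 5) by ring, cos_two_mul, cos_pi_div_five]
  linear_combination h / 8

theorem sin_four_pi_div_five : sin (4 * π / 5) = (√5 - 1) / 2 * sin (2 * π / 5) := by
  rw [show 4 * π / 5 = 2 * (2 * π / 5) by ring, sin_two_mul, cos_two_pi_div_five]
  ring

theorem cos_four_pi_div_five : cos (4 * π / 5) = -(√5 + 1) / 4 := by
  have h : (√5) ^ 2 = 5 := Real.sq_sqrt (by norm_num)
  rw [show 4 * π / 5 = 2 * (2 * π / 5) by ring, cos_two_mul, cos_two_pi_div_five]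
  linear_combination h / 8

theorem sin_two_pi_div_five_pos : 0 < sin (2 * π / 5) :=
  sin_pos_of_pos_of_lt_pi (by positivity) (by linarith [pi_pos])

theorem regPentagon_zero : regPentagon 0 = (1, 0) := by
  simp [regPentagon]

theorem regPentagon_one : regPentagon 1 = ((√5 - 1) / 4, sin (2 * π / 5)) := by
  simp [regPentagon, cos_two_pi_div_five]

theorem regPentagon_two :
    regPentagon 2 = (-(√5 + 1) / 4, (√5 - 1) / 2 * sin (2 * π / 5)) := by
  have h : 2 * π * ((2 : Fin 5) : ℕ) / 5 = 4 * π / 5 := by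
    norm_num [show ((2 : Fin 5) : ℕ) = 2 from rfl]; ring
  rw [regPentagon, h, cos_four_pi_div_five, sin_four_pi_div_five]

theorem regPentagon_three :
    regPentagon 3 = (-(√5 + 1) / 4, -((√5 - 1) / 2 * sin (2 * π / 5))) := by
  have h : 2 * π * ((3 : Fin 5) : ℕ) / 5 = 2 * π - 4 * π / 5 := by
    norm_num [show ((3 : Fin 5) : ℕ) = 3 from rfl]; ring
  rw [regPentagon, h, cos_two_pi_sub, sin_two_pi_sub, cos_four_pi_div_five,
    sin_four_pi_div_five]

theorem regPentagon_four : regPentagon 4 = ((√5 - 1) / 4, -sin (2 * π / 5)) := by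
  have h : 2 * π * ((4 : Fin 5) : ℕ) / 5 = 2 * π - 2 * π / 5 := by
    norm_num [show ((4 : Fin 5) : ℕ) = 4 from rfl]; ring
  rw [regPentagon, h, cos_two_pi_sub, sin_two_pi_sub, cos_two_pi_div_five]

/-- A diagonal of the regular pentagon is the golden ratio times the side parallel to it. -/
theorem regPentagon_diagonal (s : Fin 5) :
    regPentagon (s + 3) - regPentagon s =
      ((√5 + 1) / 2) • (regPentagon (s + 2) - regPentagon (s + 1)) := by
  have h : (√5) ^ 2 = 5 := Real.sq_sqrt (by norm_num)
  have h0 := regPentagon_zero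
  have h1 := regPentagon_one
  have h2 := regPentagon_two
  have h3 := regPentagon_three
  have h4 := regPentagon_four
  fin_cases s <;>
    simp only [Fin.zero_eta, Fin.mk_one, Fin.reduceFinMk, Fin.reduceAdd, zero_add,
      h0, h1, h2, h3, h4] <;>
    ext <;> simp only [Prod.fst_sub, Prod.snd_sub, Prod.smul_fst, Prod.smul_snd, smul_eq_mul] <;>
    grind

/-- An affine map sends the relation between diagonals and sides to its image. -/
theorem map_regPentagon_diagonal (T : (ℝ × ℝ) →ᵃ[ℝ] (ℝ × ℝ)) (s : Fin 5) :
    T (regPentagon (s + 3)) - T (regPentagon s) =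
      ((√5 + 1) / 2) • (T (regPentagon (s + 2)) - T (regPentagon (s + 1))) := by
  simp only [← vsub_eq_sub, ← T.linearMap_vsub]
  rw [← map_smul]
  simp only [vsub_eq_sub, regPentagon_diagonal]

/-- The affine map sending `(1, 0)` to `v` and, more generally, the regular pentagon to the
pentagon `(v, -g • u, -g • v, u, u + v)` with `g = (√5 - 1) / 2`. -/
noncomputable def pentagonMap (u v : ℝ × ℝ) : (ℝ × ℝ) →ᵃ[ℝ] (ℝ × ℝ) :=
  ((LinearMap.fst ℝ ℝ ℝ).smulRight (v - ((5 - √5) / 10) • (u + v)) +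
    (LinearMap.snd ℝ ℝ ℝ).smulRight
      ((2 * sin (2 * π / 5))⁻¹ • (-((√5 + 1) / 2) • u - v))).toAffineMap +
    AffineMap.const ℝ (ℝ × ℝ) (((5 - √5) / 10) • (u + v))

theorem pentagonMap_apply (u v : ℝ × ℝ) (x y : ℝ) :
    pentagonMap u v (x, y) = x • (v - ((5 - √5) / 10) • (u + v)) +
      y • ((2 * sin (2 * π / 5))⁻¹ • (-((√5 + 1) / 2) • u - v)) +
      ((5 - √5) / 10) • (u + v) := by
  simp [pentagonMap]

theorem pentagonMap_bijective {u v : ℝ × ℝ} (huv : LinearIndependent ℝ ![u, v]) :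
    Function.Bijective (pentagonMap u v) := by
  have h : (√5) ^ 2 = 5 := Real.sq_sqrt (by norm_num)
  have hs := sin_two_pi_div_five_pos
  have hinj : Function.Injective (pentagonMap u v) := by
    rw [← AffineMap.linear_injective_iff, injective_iff_map_eq_zero]
    rintro ⟨x, y⟩ hxy
    have hxy' : x • (v - ((5 - √5) / 10) • (u + v)) +
        y • ((2 * sin (2 * π / 5))⁻¹ • (-((√5 + 1) / 2) • u - v)) = 0 := by
      simpa [pentagonMap] using hxy
    obtain ⟨hu, hv⟩ := LinearIndependent.pair_iff.1 huv
      (-((5 - √5) / 10) * x - (√5 + 1) / 2 * (y * (2 * sin (2 * π / 5))⁻¹))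
      ((1 - (5 - √5) / 10) * x - y * (2 * sin (2 * π / 5))⁻¹)
      (by rw [← hxy']; module)
    have hx : x = 0 := by
      have : (√5 + 5) * x = 0 := by
        linear_combination 5 * ((√5 + 1) / 2 * hv - hu) - x * h / 4
      exact (mul_eq_zero.1 this).resolve_left (by positivity)
    have hy : y = 0 := by
      subst hx
      simpa [hs.ne'] using hv
    rw [hx, hy, Prod.mk_zero_zero]
  refine ⟨hinj, ?_⟩
  rw [← AffineMap.linear_surjective_iff, ← LinearMap.injective_iff_surjective,
    AffineMap.linear_injective_iff]
  exact hinj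

theorem pentagonMap_regPentagon (u v : ℝ × ℝ) (k : Fin 5) :
    pentagonMap u v (regPentagon k) =
      ![v, -((√5 - 1) / 2) • u, -((√5 - 1) / 2) • v, u, u + v] k := by
  have h : (√5) ^ 2 = 5 := Real.sq_sqrt (by norm_num)
  have hs := sin_two_pi_div_five_pos.ne'
  have h0 := regPentagon_zero
  have h1 := regPentagon_one
  have h2 := regPentagon_two
  have h3 := regPentagon_three
  have h4 := regPentagon_four
  fin_cases k <;>
    simp only [Fin.zero_eta, Fin.mk_one, Fin.reduceFinMk, h0, h1, h2, h3, h4,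
      pentagonMap_apply] <;>
    ext <;> simp <;> field_simp <;> grind

/-- The parametrized pentagon `(v, −a·u, −b·v, u, c·u + d·v)` is the image, in cyclic
order, of the vertices of a regular pentagon under an invertible affine map iff
`a = b = (√5 − 1)/2` and `c = d = 1`. -/
theorem affine_regular_pentagon_iff (u v : ℝ × ℝ) (huv : LinearIndependent ℝ ![u, v])
    (a b c d : ℝ) (ha : 0 < a) (hb : 0 < b) (hc : 0 < c) (hd : 0 < d)
    (A B C D E : ℝ × ℝ)
    (hA : A = v) (hB : B = -a • u) (hC : C = -b • v) (hD : D = u)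
    (hE : E = c • u + d • v) :
    (∃ T : (ℝ × ℝ) →ᵃ[ℝ] (ℝ × ℝ), Function.Bijective T ∧
      ∃ s : Fin 5,
        (∀ k : Fin 5, ![A, B, C, D, E] k = T (regPentagon (s + k))) ∨
        (∀ k : Fin 5, ![A, B, C, D, E] k = T (regPentagon (s - k)))) ↔
      a = (Real.sqrt 5 - 1) / 2 ∧ b = (Real.sqrt 5 - 1) / 2 ∧ c = 1 ∧ d = 1 := by
  have h : (√5) ^ 2 = 5 := Real.sq_sqrt (by norm_num)
  subst hA hB hC hD hE
  constructor
  · rintro ⟨T, -, s, hT⟩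
    obtain ⟨hDA, hEB⟩ : D - A = ((√5 + 1) / 2) • (-b • A - -a • D) ∧
        (c • D + d • A) - -a • D = ((√5 + 1) / 2) • (D - -b • A) := by
      rcases hT with hT | hT
      · have e0 : A = T (regPentagon s) := by simpa using hT 0
        have e1 : -a • D = T (regPentagon (s + 1)) := by simpa using hT 1
        have e2 : -b • A = T (regPentagon (s + 2)) := by simpa using hT 2
        have e3 : D = T (regPentagon (s + 3)) := by simpa using hT 3
        have e4 : c • D + d • A = T (regPentagon (s + 4)) := by simpa using hT 4
        have r0 := map_regPentagon_diagonal T s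
        have r1 := map_regPentagon_diagonal T (s + 1)
        simp only [add_assoc, Fin.reduceAdd] at r1
        rw [← e0, ← e1, ← e2, ← e3] at r0
        rw [← e1, ← e2, ← e3, ← e4] at r1
        exact ⟨r0, r1⟩
      · have e0 : A = T (regPentagon s) := by simpa using hT 0
        have e1 : -a • D = T (regPentagon (s - 1)) := by simpa using hT 1
        have e2 : -b • A = T (regPentagon (s - 2)) := by simpa using hT 2
        have e3 : D = T (regPentagon (s - 3)) := by simpa using hT 3
        have e4 : c • D + d • A = T (regPentagon (s - 4)) := by simpa using hT 4
        have r0 := map_regPentagon_diagonal T (s - 3)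
        have r1 := map_regPentagon_diagonal T (s - 4)
        simp only [sub_add, Fin.reduceSub, sub_zero] at r0 r1
        rw [← e0, ← e1, ← e2, ← e3] at r0
        rw [← e1, ← e2, ← e3, ← e4] at r1
        constructor
        · linear_combination (norm := module) (-1 : ℝ) • r0
        · linear_combination (norm := module) (-1 : ℝ) • r1
    rw [LinearIndependent.pair_iff] at huv
    obtain ⟨h1, h2⟩ := huv (1 - (√5 + 1) / 2 * a) (-1 + (√5 + 1) / 2 * b)
      (by rw [← sub_eq_zero] at hDA; rw [← hDA]; module)
    obtain ⟨h3, h4⟩ := huv (c + a - (√5 + 1) / 2) (d - (√5 + 1) / 2 * b)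
      (by rw [← sub_eq_zero] at hEB; rw [← hEB]; module)
    have ha' : a = (√5 - 1) / 2 := by
      linear_combination -(√5 - 1) / 2 * h1 - a / 4 * h
    have hb' : b = (√5 - 1) / 2 := by
      linear_combination (√5 - 1) / 2 * h2 - b / 4 * h
    exact ⟨ha', hb', by linarith, by linarith⟩
  · rintro ⟨rfl, rfl, rfl, rfl⟩
    refine ⟨pentagonMap D A, pentagonMap_bijective huv, 0, Or.inl fun k => ?_⟩
    rw [zero_add, pentagonMap_regPentagon, one_smul, one_smul]
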